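/- Suppose the operator L satisfies the positive maximum principle on M₊(E). Then q₁ is a diagonal multiplication operator: there exists α ∈ C(E) with α ≥ 0 such that q₁(g,h)(x) = α(x)·g(x)·h(x) for all g, h ∈ C(E) and all x ∈ E. -/

import Mathlib

open MeasureTheory Topology

/-- The topological support of a measure: points all of whose open neighborhoods
have positive measure. -/
def mSupport {E : Type*} [TopologicalSpace E] [MeasurableSpace E]
    (ν : Measure E) : Set E :=
  {x : E | ∀ U : Set E, IsOpen U → x ∈ U → 0 < ν U}

/-- The action of the operator `L` (with parameters `b₀, b₁, q₀, q₁, q₂`) on the cylindrical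
function `ν ↦ φ(⟨g₁,ν⟩, …, ⟨g_m,ν⟩)`, evaluated at `ν`. -/
noncomputable def Lapp {E : Type*} [MetricSpace E] [MeasurableSpace E]
    (b₀ : C(E, ℝ) →ₗ[ℝ] ℝ) (b₁ : C(E, ℝ) →ₗ[ℝ] C(E, ℝ))
    (q₀ : C(E, ℝ) →ₗ[ℝ] C(E, ℝ) →ₗ[ℝ] ℝ)
    (q₁ : C(E, ℝ) →ₗ[ℝ] C(E, ℝ) →ₗ[ℝ] C(E, ℝ))
    (q₂ : C(E, ℝ) →ₗ[ℝ] C(E, ℝ) →ₗ[ℝ] C(E × E, ℝ))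
    (m : ℕ) (φ : (Fin m → ℝ) → ℝ) (g : Fin m → C(E, ℝ)) (ν : FiniteMeasure E) : ℝ :=
  (∑ i, fderiv ℝ φ (fun k => ∫ x, g k x ∂(ν : Measure E)) (Pi.single i 1) *
      (b₀ (g i) + ∫ x, b₁ (g i) x ∂(ν : Measure E))) +
  (1 / 2) * ∑ i, ∑ j,
    (fderiv ℝ (fun w => fderiv ℝ φ w (Pi.single i 1))
        (fun k => ∫ x, g k x ∂(ν : Measure E)) (Pi.single j 1)) *
      (q₀ (g i) (g j) + (∫ x, q₁ (g i) (g j) x ∂(ν : Measure E)) +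
        ∫ p, q₂ (g i) (g j) p ∂((ν : Measure E).prod (ν : Measure E)))

/-- `φ : ℝ^m → ℝ` is a polynomial function. -/
def IsPolyFn {m : ℕ} (φ : (Fin m → ℝ) → ℝ) : Prop :=
  ∃ P : MvPolynomial (Fin m) ℝ, ∀ v, φ v = MvPolynomial.eval v P

/-- The operator `L` satisfies the positive maximum principle on `M₊(E)`: for every
cylindrical function `f(ν) = φ(⟨g₁,ν⟩, …, ⟨g_m,ν⟩)` whose outer function `φ` is smooth and
either a polynomial or compactly supported, and every global maximizer `ν*` of `f` over
`M₊(E)` with `f(ν*) ≥ 0`, one has `Lf(ν*) ≤ 0`. -/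
def SatisfiesPMP {E : Type*} [MetricSpace E] [MeasurableSpace E]
    (b₀ : C(E, ℝ) →ₗ[ℝ] ℝ) (b₁ : C(E, ℝ) →ₗ[ℝ] C(E, ℝ))
    (q₀ : C(E, ℝ) →ₗ[ℝ] C(E, ℝ) →ₗ[ℝ] ℝ)
    (q₁ : C(E, ℝ) →ₗ[ℝ] C(E, ℝ) →ₗ[ℝ] C(E, ℝ))
    (q₂ : C(E, ℝ) →ₗ[ℝ] C(E, ℝ) →ₗ[ℝ] C(E × E, ℝ)) : Prop :=
  ∀ (m : ℕ) (φ : (Fin m → ℝ) → ℝ), ContDiff ℝ (⊤ : ℕ∞) φ →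
    (IsPolyFn φ ∨ HasCompactSupport φ) →
    ∀ (g : Fin m → C(E, ℝ)) (νstar : FiniteMeasure E),
      (∀ ν : FiniteMeasure E,
        φ (fun i => ∫ x, g i x ∂(ν : Measure E)) ≤
          φ (fun i => ∫ x, g i x ∂(νstar : Measure E))) →
      0 ≤ φ (fun i => ∫ x, g i x ∂(νstar : Measure E)) →
      Lapp b₀ b₁ q₀ q₁ q₂ m φ g νstar ≤ 0

/-- For an outer function that is a polynomial in one pairing `⟨g,ν⟩`, the operator `L` only sees
the first two derivatives of that polynomial. -/
lemma Lapp_polynomial {E : Type*} [MetricSpace E] [MeasurableSpace E]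
    (b₀ : C(E, ℝ) →ₗ[ℝ] ℝ) (b₁ : C(E, ℝ) →ₗ[ℝ] C(E, ℝ))
    (q₀ : C(E, ℝ) →ₗ[ℝ] C(E, ℝ) →ₗ[ℝ] ℝ)
    (q₁ : C(E, ℝ) →ₗ[ℝ] C(E, ℝ) →ₗ[ℝ] C(E, ℝ))
    (q₂ : C(E, ℝ) →ₗ[ℝ] C(E, ℝ) →ₗ[ℝ] C(E × E, ℝ))
    (p : Polynomial ℝ) (g : C(E, ℝ)) (ν : FiniteMeasure E) :
    Lapp b₀ b₁ q₀ q₁ q₂ 1 (fun v => p.eval (v 0)) (fun _ => g) ν =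
      p.derivative.eval (∫ x, g x ∂(ν : Measure E)) *
          (b₀ g + ∫ x, b₁ g x ∂(ν : Measure E)) +
        1 / 2 * (p.derivative.derivative.eval (∫ x, g x ∂(ν : Measure E)) *
          (q₀ g g + (∫ x, q₁ g g x ∂(ν : Measure E)) +
            ∫ z, q₂ g g z ∂((ν : Measure E).prod (ν : Measure E)))) := by
  have key : ∀ (q : Polynomial ℝ) (w : Fin 1 → ℝ),
      fderiv ℝ (fun v : Fin 1 → ℝ => q.eval (v 0)) w (Pi.single 0 1) =
        q.derivative.eval (w 0) := by
    intro q w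
    have h := (q.hasDerivAt (w 0)).comp_hasFDerivAt w
      (ContinuousLinearMap.proj (R := ℝ) (φ := fun _ : Fin 1 => ℝ) 0).hasFDerivAt
    have h' : HasFDerivAt (fun v : Fin 1 → ℝ => q.eval (v 0)) _ w := h
    rw [h'.fderiv]
    simp
  simp [Lapp, key]

/-- The positive maximum principle for polynomials in one pairing `⟨g,ν⟩`. -/
lemma SatisfiesPMP.polynomial_le {E : Type*} [MetricSpace E] [MeasurableSpace E]
    {b₀ : C(E, ℝ) →ₗ[ℝ] ℝ} {b₁ : C(E, ℝ) →ₗ[ℝ] C(E, ℝ)}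
    {q₀ : C(E, ℝ) →ₗ[ℝ] C(E, ℝ) →ₗ[ℝ] ℝ}
    {q₁ : C(E, ℝ) →ₗ[ℝ] C(E, ℝ) →ₗ[ℝ] C(E, ℝ)}
    {q₂ : C(E, ℝ) →ₗ[ℝ] C(E, ℝ) →ₗ[ℝ] C(E × E, ℝ)}
    (hPMP : SatisfiesPMP b₀ b₁ q₀ q₁ q₂)
    (p : Polynomial ℝ) (g : C(E, ℝ)) (ν : FiniteMeasure E)
    (hmax : ∀ μ : FiniteMeasure E,
      p.eval (∫ x, g x ∂(μ : Measure E)) ≤ p.eval (∫ x, g x ∂(ν : Measure E)))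
    (hnonneg : 0 ≤ p.eval (∫ x, g x ∂(ν : Measure E))) :
    p.derivative.eval (∫ x, g x ∂(ν : Measure E)) *
          (b₀ g + ∫ x, b₁ g x ∂(ν : Measure E)) +
        1 / 2 * (p.derivative.derivative.eval (∫ x, g x ∂(ν : Measure E)) *
          (q₀ g g + (∫ x, q₁ g g x ∂(ν : Measure E)) +
            ∫ z, q₂ g g z ∂((ν : Measure E).prod (ν : Measure E)))) ≤ 0 := by
  rw [← Lapp_polynomial]
  refine hPMP 1 (fun v => p.eval (v 0)) ?_ (Or.inl ?_) _ ν hmax hnonneg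
  · exact (p.contDiff_aeval _).comp (contDiff_apply ℝ ℝ 0)
  · refine ⟨Polynomial.aeval (MvPolynomial.X 0) p, fun v => ?_⟩
    rw [← MvPolynomial.coe_aeval_eq_eval, RingHom.coe_coe, ← Polynomial.aeval_algHom_apply]
    simp [Polynomial.aeval_def, Polynomial.eval₂_eq_eval_map]

/-- The point mass of weight `r` at `x`. -/
noncomputable def weightedDirac {E : Type*} [MeasurableSpace E] (r : NNReal) (x : E) :
    FiniteMeasure E :=
  r • ⟨Measure.dirac x, inferInstance⟩

lemma integral_weightedDirac {E : Type*} [MeasurableSpace E] [MeasurableSingletonClass E]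
    (r : NNReal) (x : E) (f : E → ℝ) :
    ∫ y, f y ∂(weightedDirac r x : Measure E) = r * f x := by
  have : (weightedDirac r x : Measure E) = r • Measure.dirac x := rfl
  rw [this, integral_smul_nnreal_measure, integral_dirac]
  rfl

lemma integral_weightedDirac_prod {E : Type*} [MeasurableSpace E] [MeasurableSingletonClass E]
    (r : NNReal) (x : E) (f : E × E → ℝ) :
    ∫ z, f z ∂((weightedDirac r x : Measure E).prod (weightedDirac r x : Measure E)) =
      r ^ 2 * f (x, x) := by
  have : (weightedDirac r x : Measure E) = (r : ENNReal) • Measure.dirac x := rfl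
  rw [this, Measure.prod_smul_left, Measure.prod_smul_right, Measure.dirac_prod_dirac,
    integral_smul_measure, integral_smul_measure, integral_dirac]
  simp [pow_two, mul_assoc]

/-- The diffusion form of `L` at the measure `r δ_x`. -/
def diracForm {E : Type*} [MetricSpace E]
    (q₀ : C(E, ℝ) →ₗ[ℝ] C(E, ℝ) →ₗ[ℝ] ℝ)
    (q₁ : C(E, ℝ) →ₗ[ℝ] C(E, ℝ) →ₗ[ℝ] C(E, ℝ))
    (q₂ : C(E, ℝ) →ₗ[ℝ] C(E, ℝ) →ₗ[ℝ] C(E × E, ℝ))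
    (r : NNReal) (x : E) (g h : C(E, ℝ)) : ℝ :=
  q₀ g h + r * q₁ g h x + (r : ℝ) ^ 2 * q₂ g h (x, x)

section

variable {E : Type*} [MetricSpace E] [MeasurableSpace E] [BorelSpace E]
  {b₀ : C(E, ℝ) →ₗ[ℝ] ℝ} {b₁ : C(E, ℝ) →ₗ[ℝ] C(E, ℝ)}
  {q₀ : C(E, ℝ) →ₗ[ℝ] C(E, ℝ) →ₗ[ℝ] ℝ}
  {q₁ : C(E, ℝ) →ₗ[ℝ] C(E, ℝ) →ₗ[ℝ] C(E, ℝ)}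
  {q₂ : C(E, ℝ) →ₗ[ℝ] C(E, ℝ) →ₗ[ℝ] C(E × E, ℝ)}

/-- The diffusion form is positive semidefinite, by testing with
`ν ↦ -(⟨g,ν⟩ - ⟨g,r δ_x⟩)²`. -/
lemma SatisfiesPMP.diracForm_nonneg (hPMP : SatisfiesPMP b₀ b₁ q₀ q₁ q₂)
    (r : NNReal) (x : E) (g : C(E, ℝ)) : 0 ≤ diracForm q₀ q₁ q₂ r x g g := by
  have h := hPMP.polynomial_le (-(Polynomial.X - Polynomial.C (r * g x)) ^ 2) g
    (weightedDirac r x)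
    (fun μ => by
      simp only [integral_weightedDirac, Polynomial.eval_neg, Polynomial.eval_pow,
        Polynomial.eval_sub, Polynomial.eval_X, Polynomial.eval_C]
      nlinarith [sq_nonneg ((∫ y, g y ∂(μ : Measure E)) - r * g x)])
    (by simp [integral_weightedDirac])
  simp only [integral_weightedDirac, integral_weightedDirac_prod] at h
  simp [Polynomial.derivative_pow] at h
  unfold diracForm
  linarith

/-- The diffusion form vanishes on nonnegative functions that vanish on `r δ_x`, by testing with
`ν ↦ -t + c t² - c² t³` where `t = ⟨g,ν⟩` and `c` is arbitrary. -/
lemma SatisfiesPMP.diracForm_self_eq_zero (hPMP : SatisfiesPMP b₀ b₁ q₀ q₁ q₂)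
    (r : NNReal) (x : E) (g : C(E, ℝ)) (hg : ∀ y, 0 ≤ g y) (hgx : r * g x = 0) :
    diracForm q₀ q₁ q₂ r x g g = 0 := by
  refine le_antisymm ?_ (hPMP.diracForm_nonneg r x g)
  have key : ∀ c : ℝ,
      c * diracForm q₀ q₁ q₂ r x g g ≤ b₀ g + r * b₁ g x := by
    intro c
    have h := hPMP.polynomial_le
      (-Polynomial.X + Polynomial.C c * Polynomial.X ^ 2 -
        Polynomial.C (c ^ 2) * Polynomial.X ^ 3) g (weightedDirac r x)
      (fun μ => by
        simp only [integral_weightedDirac, hgx]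
        have ht : 0 ≤ ∫ y, g y ∂(μ : Measure E) := integral_nonneg hg
        generalize (∫ y, g y ∂(μ : Measure E)) = t at ht
        simp only [Polynomial.eval_sub, Polynomial.eval_add, Polynomial.eval_neg,
          Polynomial.eval_mul, Polynomial.eval_pow, Polynomial.eval_X, Polynomial.eval_C]
        nlinarith [mul_nonneg ht (sq_nonneg (c * t - 1 / 2))])
      (by simp [integral_weightedDirac, hgx])
    simp only [integral_weightedDirac, integral_weightedDirac_prod, hgx] at h
    simp [Polynomial.derivative_pow] at h
    unfold diracForm
    linarith
  by_contra! hpos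
  have h := key ((b₀ g + r * b₁ g x + 1) / diracForm q₀ q₁ q₂ r x g g)
  rw [div_mul_cancel₀ _ hpos.ne'] at h
  linarith

/-- A nonnegative function vanishing at `x` lies in the kernel of the diffusion form at `r δ_x`. -/
lemma SatisfiesPMP.diracForm_eq_zero_of_nonneg (hPMP : SatisfiesPMP b₀ b₁ q₀ q₁ q₂)
    (hq₀ : ∀ g h : C(E, ℝ), q₀ g h = q₀ h g) (hq₁ : ∀ g h : C(E, ℝ), q₁ g h = q₁ h g)
    (hq₂ : ∀ g h : C(E, ℝ), q₂ g h = q₂ h g)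
    (r : NNReal) (x : E) (g h : C(E, ℝ)) (hh : ∀ y, 0 ≤ h y) (hhx : h x = 0) :
    diracForm q₀ q₁ q₂ r x g h = 0 := by
  have hself := hPMP.diracForm_self_eq_zero r x h hh (by simp [hhx])
  have key : ∀ s : ℝ,
      0 ≤ diracForm q₀ q₁ q₂ r x g g + 2 * s * diracForm q₀ q₁ q₂ r x g h := by
    intro s
    have hs := hPMP.diracForm_nonneg r x (g + s • h)
    have expand : diracForm q₀ q₁ q₂ r x (g + s • h) (g + s • h) =
        diracForm q₀ q₁ q₂ r x g g + 2 * s * diracForm q₀ q₁ q₂ r x g h +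
          s ^ 2 * diracForm q₀ q₁ q₂ r x h h := by
      simp only [diracForm, map_add, map_smul, LinearMap.add_apply, LinearMap.smul_apply,
        ContinuousMap.add_apply, ContinuousMap.smul_apply, smul_eq_mul,
        hq₀ h g, hq₁ h g, hq₂ h g]
      ring
    rw [expand, hself] at hs
    linarith
  by_contra hne
  have hs := key (-(diracForm q₀ q₁ q₂ r x g g + 1) / (2 * diracForm q₀ q₁ q₂ r x g h))
  have e : 2 * (-(diracForm q₀ q₁ q₂ r x g g + 1) / (2 * diracForm q₀ q₁ q₂ r x g h)) *
      diracForm q₀ q₁ q₂ r x g h = -(diracForm q₀ q₁ q₂ r x g g + 1) := by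
    field_simp
  linarith

/-- `q₁` is local: `q₁(g,h)(x) = 0` as soon as `h(x) = 0`. -/
lemma SatisfiesPMP.q₁_apply_eq_zero (hPMP : SatisfiesPMP b₀ b₁ q₀ q₁ q₂)
    (hq₀ : ∀ g h : C(E, ℝ), q₀ g h = q₀ h g) (hq₁ : ∀ g h : C(E, ℝ), q₁ g h = q₁ h g)
    (hq₂ : ∀ g h : C(E, ℝ), q₂ g h = q₂ h g)
    (x : E) (g h : C(E, ℝ)) (hhx : h x = 0) : q₁ g h x = 0 := by
  have nonneg_case : ∀ k : C(E, ℝ), (∀ y, 0 ≤ k y) → k x = 0 → q₁ g k x = 0 := by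
    intro k hk hkx
    have h0 := hPMP.diracForm_eq_zero_of_nonneg hq₀ hq₁ hq₂ 0 x g k hk hkx
    have h1 := hPMP.diracForm_eq_zero_of_nonneg hq₀ hq₁ hq₂ 1 x g k hk hkx
    have h2 := hPMP.diracForm_eq_zero_of_nonneg hq₀ hq₁ hq₂ 2 x g k hk hkx
    simp [diracForm] at h0 h1 h2
    linarith
  have hpos := nonneg_case (h ⊔ 0) (fun y => by simp) (by simp [hhx])
  have hneg := nonneg_case (h ⊔ 0 - h) (fun y => by simp) (by simp [hhx])
  rw [map_sub, ContinuousMap.sub_apply, hpos] at hneg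
  linarith

/-- `q₁(1,1)` is nonnegative. -/
lemma SatisfiesPMP.q₁_one_one_nonneg (hPMP : SatisfiesPMP b₀ b₁ q₀ q₁ q₂) (x : E) :
    0 ≤ q₁ 1 1 x := by
  have h0 := hPMP.diracForm_self_eq_zero 0 x 1 (fun y => by simp) (by simp)
  simp [diracForm] at h0
  by_contra! hneg
  set a := q₁ 1 1 x
  set c := q₂ 1 1 (x, x)
  have hden : 0 < 2 * (|c| + 1) := by positivity
  set r : ℝ := -a / (2 * (|c| + 1)) with hr
  have hrpos : 0 < r := div_pos (by linarith) hden
  have h := hPMP.diracForm_nonneg ⟨r, hrpos.le⟩ x 1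
  have h' : 0 ≤ r * (a + r * c) := by
    have : diracForm q₀ q₁ q₂ ⟨r, hrpos.le⟩ x 1 1 = q₀ 1 1 + r * a + r ^ 2 * c := rfl
    rw [this, h0] at h
    linarith
  have h2 : 0 ≤ a + r * c := nonneg_of_mul_nonneg_right h' hrpos
  have h3 : r * (2 * (|c| + 1)) = -a := div_mul_cancel₀ _ hden.ne'
  nlinarith [mul_le_mul_of_nonneg_left (le_abs_self c) hrpos.le, abs_nonneg c]

end

/-- If `L` satisfies the positive maximum principle on `M₊(E)`, then `q₁` is a diagonal
multiplication operator: `q₁(g,h)(x) = α(x)·g(x)·h(x)` for some `0 ≤ α ∈ C(E)`. -/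
theorem stmt_12 {E : Type*} [MetricSpace E] [CompactSpace E] [MeasurableSpace E] [BorelSpace E]
    (b₀ : C(E, ℝ) →ₗ[ℝ] ℝ) (b₁ : C(E, ℝ) →ₗ[ℝ] C(E, ℝ))
    (q₀ : C(E, ℝ) →ₗ[ℝ] C(E, ℝ) →ₗ[ℝ] ℝ)
    (q₁ : C(E, ℝ) →ₗ[ℝ] C(E, ℝ) →ₗ[ℝ] C(E, ℝ))
    (q₂ : C(E, ℝ) →ₗ[ℝ] C(E, ℝ) →ₗ[ℝ] C(E × E, ℝ))
    (hq₀ : ∀ g h : C(E, ℝ), q₀ g h = q₀ h g)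
    (hq₁ : ∀ g h : C(E, ℝ), q₁ g h = q₁ h g)
    (hq₂ : ∀ g h : C(E, ℝ), q₂ g h = q₂ h g)
    (hq₂val : ∀ (g h : C(E, ℝ)) (x y : E), q₂ g h (x, y) = q₂ g h (y, x))
    (hPMP : SatisfiesPMP b₀ b₁ q₀ q₁ q₂) :
    ∃ α : C(E, ℝ), (∀ x, 0 ≤ α x) ∧
    ∀ (g h : C(E, ℝ)) (x : E), q₁ g h x = α x * g x * h x := by
  refine ⟨q₁ 1 1, hPMP.q₁_one_one_nonneg, fun g h x => ?_⟩
  have split : ∀ k l : C(E, ℝ), q₁ k l x = l x * q₁ k 1 x := by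
    intro k l
    have hz := hPMP.q₁_apply_eq_zero hq₀ hq₁ hq₂ x k (l - l x • 1) (by simp)
    rw [map_sub, map_smul, ContinuousMap.sub_apply, ContinuousMap.smul_apply,
      smul_eq_mul] at hz
    linarith
  rw [split g h, hq₁ g 1, split 1 g]
  ring
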